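/- Define f : ℂ → ℂ by f(w) = 2·(re w) + (im w)·i. There is no function F : ℂ → ℂ that is differentiable at 0 as a map of real vector spaces (DifferentiableAt ℝ F 0) and satisfies F(w)² = f(w²) for all w in some neighborhood of 0. (Consequently, the lift through the double branched cover w ↦ w² of a diffeomorphism whose derivative at a branch point is (x,y) ↦ (2x,y) cannot be differentiable at the ramification point.) -/

import Mathlib

open Complex Filter

/-- If the square of `F` agrees near `0` with a function homogeneous of degree two over `ℝ`,
then so does the square of the derivative of `F` at `0`. -/
lemma HasFDerivAt.sq_apply_eq_of_homogeneous {F g : ℂ → ℂ} {L : ℂ →L[ℝ] ℂ}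
    (hL : HasFDerivAt F L 0) (hg : ∀ (t : ℝ) (v : ℂ), g (t • v) = (t : ℂ) ^ 2 * g v)
    (hF : ∀ᶠ w in nhds (0 : ℂ), F w ^ 2 = g w) (v : ℂ) : L v ^ 2 = g v := by
  have hF0 : F 0 = 0 := by
    have hg0 : g 0 = 0 := by simpa using hg 0 0
    simpa [hg0] using hF.self_of_nhds
  have hslope := (hL.hasLineDerivAt v).tendsto_slope_zero.pow 2
  have hcont : Tendsto (fun t : ℝ => t • v) (nhdsWithin 0 {0}ᶜ) (nhds 0) := by
    have h : Continuous fun t : ℝ => t • v := by fun_prop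
    simpa using (h.tendsto 0).mono_left nhdsWithin_le_nhds
  refine tendsto_nhds_unique hslope (tendsto_const_nhds.congr' ?_)
  filter_upwards [hcont.eventually hF, self_mem_nhdsWithin] with t ht ht0
  have ht0' : (t : ℂ) ≠ 0 := by exact_mod_cast ht0
  rw [zero_add, hF0, sub_zero, Complex.real_smul (x := t⁻¹), mul_pow, ht, hg]
  push_cast
  field_simp

/-- Let `f : ℂ → ℂ` be the real-linear map `(x, y) ↦ (2x, y)`, i.e.
`f w = 2 * re w + (im w) * I`.  There is no function `F : ℂ → ℂ` which is differentiable at `0`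
as a map of real vector spaces and satisfies `F w ^ 2 = f (w ^ 2)` for all `w` in some
neighborhood of `0`.  (So the lift of `f` through the double branched cover `w ↦ w ^ 2` cannot
be differentiable at the ramification point.) -/
theorem no_differentiable_lift_through_branched_cover
    (f : ℂ → ℂ) (hf : ∀ w : ℂ, f w = 2 * (w.re : ℂ) + (w.im : ℂ) * Complex.I) :
    ¬ ∃ F : ℂ → ℂ, DifferentiableAt ℝ F 0 ∧ ∀ᶠ w in nhds (0 : ℂ), F w ^ 2 = f (w ^ 2) := by
  rintro ⟨F, ⟨L, hL⟩, hF⟩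
  have key := hL.sq_apply_eq_of_homogeneous (g := fun w => f (w ^ 2)) (fun t v => by
    have h : (t • v) ^ 2 = (t ^ 2 : ℝ) • v ^ 2 := by rw [smul_pow]
    simp only [h, hf, Complex.smul_re, Complex.smul_im, smul_eq_mul]
    push_cast
    ring) hF
  have h1 : L 1 ^ 2 = 2 := by simpa [hf] using key 1
  have hI : L I ^ 2 = -2 := by simpa [hf] using key I
  have hsum : (L 1 + L I) ^ 2 = 2 * I := by
    have h : (1 + I) ^ 2 = 2 * I := by linear_combination I_sq
    simpa [h, hf] using key (1 + I)
  have hmul : L 1 * L I = I := by linear_combination (hsum - h1 - hI) / 2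
  have hcontra : (-4 : ℂ) = -1 := by
    calc (-4 : ℂ) = L 1 ^ 2 * L I ^ 2 := by rw [h1, hI]; norm_num
      _ = -1 := by rw [← mul_pow, hmul, I_sq]
  norm_num at hcontra
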